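/- arXiv:1907.02929 — 2 statements merged into one kernel-verified Lean document; each statement's English description precedes it below -/
import Mathlib

section
/- Let π be a node map between G and H, let (f, σ) be a swap of π of size K, and let π' := SWAP(π, f, σ) (which is again a node map). Define V_C^G := {u : V_G | some u is the first component of some element of F}, V_C^H := {v : V_H | some v is the second component of some element of F}, E_C^G := {e ∈ E(G) | e has at least one endpoint in V_C^G}, and E_C^H := {f ∈ E(H) | f has at least one endpoint in V_C^H}. Then c(P_{π'}) − c(P_π) = Δ, where Δ equals the sum of: c_V(u, partner_{π'}(u)) over all u ∈ V_C^G substituted under π', plus c_V(u, ε) over all u ∈ V_C^G deleted under π', plus c_V(ε, v) over all v ∈ V_C^H inserted under π', plus c_E(e, π'(e)) over all e ∈ E_C^G substituted under π', plus c_E(e, ε) over all e ∈ E_C^G deleted under π', plus c_E(ε, f) over all f ∈ E_C^H inserted under π', minus the six corresponding sums computed for π instead of π'. -/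
open scoped Classical

/-- A node map between two graphs with node sets `VG` and `VH`: a finite set of
assignments (pairs of optional nodes, `none` modelling the dummy symbol ε) such that
every node of `G` occurs as the first component of exactly one assignment, and every
node of `H` occurs as the second component of exactly one assignment. -/
def IsNodeMap {VG VH : Type*} (π : Finset (Option VG × Option VH)) : Prop :=
  (∀ u : VG, ∃! w : Option VH, (some u, w) ∈ π) ∧
    (∀ v : VH, ∃! w : Option VG, (w, some v) ∈ π)

/-- A swap of size `K` of the node map `π`: an injective map `f` from a `K`-element
index type `S` into `π`, together with a permutation `σ` of `S` that is a single
`K`-cycle (its support is all of `S`). -/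
def IsSwap {VG VH S : Type*} [Fintype S] [DecidableEq S]
    (π : Finset (Option VG × Option VH)) (f : S → Option VG × Option VH)
    (σ : Equiv.Perm S) (K : ℕ) : Prop :=
  Function.Injective f ∧ (∀ i : S, f i ∈ π) ∧ Fintype.card S = K ∧ 2 ≤ K ∧
    σ.IsCycle ∧ σ.support = Finset.univ

/-- The node map obtained from `π` by carrying out the swap `(f, σ)`: remove the
forward assignments `F = f '' S` and add the backward assignments
`β i = ((f (σ i)).1, (f i).2)`, except for the dummy assignment `(none, none)`. -/
noncomputable def SWAP {VG VH S : Type*} [Fintype S]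
    (π : Finset (Option VG × Option VH)) (f : S → Option VG × Option VH)
    (σ : Equiv.Perm S) : Finset (Option VG × Option VH) :=
  (π \ Finset.univ.image f) ∪
    (Finset.univ.filter fun i : S =>
        ((f (σ i)).1, (f i).2) ≠ ((none : Option VG), (none : Option VH))).image
      (fun i : S => ((f (σ i)).1, (f i).2))

/-- The edge `e` of `G` is substituted to the edge `fe` of `H` under the node map `π`:
`e = s(u, u')`, `fe = s(v, v')`, `π` assigns `u` to `v` and `u'` to `v'`, and
`{v, v'}` is an edge of `H`. -/
def EdgeSub {VG VH : Type*} (G : SimpleGraph VG) (H : SimpleGraph VH)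
    (π : Finset (Option VG × Option VH)) (e : Sym2 VG) (fe : Sym2 VH) : Prop :=
  e ∈ G.edgeSet ∧ ∃ u u' : VG, ∃ v v' : VH, e = s(u, u') ∧ fe = s(v, v') ∧
    (some u, some v) ∈ π ∧ (some u', some v') ∈ π ∧ H.Adj v v'

/-- The cost `c(P_π)` of the edit path induced by the node map `π`: the sum of the
costs of all node substitutions, node deletions, node insertions, edge substitutions,
edge deletions, and edge insertions induced by `π`. -/
noncomputable def editCost {VG VH : Type*} [Fintype VG] [Fintype VH]
    (G : SimpleGraph VG) (H : SimpleGraph VH)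
    (cVs : VG → VH → ℝ) (cVd : VG → ℝ) (cVi : VH → ℝ)
    (cEs : Sym2 VG → Sym2 VH → ℝ) (cEd : Sym2 VG → ℝ) (cEi : Sym2 VH → ℝ)
    (π : Finset (Option VG × Option VH)) : ℝ :=
  (∑ p ∈ π, match p with
    | (some u, some v) => cVs u v
    | (some u, none) => cVd u
    | (none, some v) => cVi v
    | (none, none) => 0)
  + (∑ e ∈ G.edgeFinset, ∑ fe ∈ H.edgeFinset, if EdgeSub G H π e fe then cEs e fe else 0)
  + (∑ e ∈ G.edgeFinset, if ∃ fe : Sym2 VH, EdgeSub G H π e fe then 0 else cEd e)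
  + (∑ fe ∈ H.edgeFinset, if ∃ e : Sym2 VG, EdgeSub G H π e fe then 0 else cEi fe)

/-- The part of the edit cost of `π` concerning only the nodes in `W ⊆ V_G` and
`X ⊆ V_H` and the edges incident with them: the sum of the costs of the node
substitutions, deletions and insertions of nodes in `W` resp. `X`, and of the edge
substitutions, deletions and insertions of edges with an endpoint in `W` resp. `X`. -/
noncomputable def localCost {VG VH : Type*} [Fintype VG] [Fintype VH]
    (G : SimpleGraph VG) (H : SimpleGraph VH)
    (cVs : VG → VH → ℝ) (cVd : VG → ℝ) (cVi : VH → ℝ)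
    (cEs : Sym2 VG → Sym2 VH → ℝ) (cEd : Sym2 VG → ℝ) (cEi : Sym2 VH → ℝ)
    (W : Finset VG) (X : Finset VH)
    (π : Finset (Option VG × Option VH)) : ℝ :=
  (∑ u ∈ W, ∑ v : VH, if (some u, some v) ∈ π then cVs u v else 0)
  + (∑ u ∈ W, if (some u, (none : Option VH)) ∈ π then cVd u else 0)
  + (∑ v ∈ X, if ((none : Option VG), some v) ∈ π then cVi v else 0)
  + (∑ e ∈ G.edgeFinset.filter (fun e => ∃ u ∈ W, u ∈ e),
      ∑ fe ∈ H.edgeFinset, if EdgeSub G H π e fe then cEs e fe else 0)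
  + (∑ e ∈ G.edgeFinset.filter (fun e => ∃ u ∈ W, u ∈ e),
      if ∃ fe : Sym2 VH, EdgeSub G H π e fe then 0 else cEd e)
  + (∑ fe ∈ H.edgeFinset.filter (fun fe => ∃ v ∈ X, v ∈ fe),
      if ∃ e : Sym2 VG, EdgeSub G H π e fe then 0 else cEi fe)

theorem Finset.sum_sub_sum_eq_of_eqOn_compl {α : Type*} {s t : Finset α} (hts : t ⊆ s)
    {g g' : α → ℝ} (h : ∀ a ∈ s, a ∉ t → g' a = g a) :
    ∑ a ∈ s, g' a - ∑ a ∈ s, g a = ∑ a ∈ t, g' a - ∑ a ∈ t, g a := by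
  simp only [← Finset.sum_sub_distrib]
  refine (Finset.sum_subset hts fun a ha hat => ?_).symm
  rw [h a ha hat, sub_self]

section

variable {VG VH S : Type*} [Fintype S]

theorem mem_SWAP_of_fst_notMem {π : Finset (Option VG × Option VH)}
    {f : S → Option VG × Option VH} {σ : Equiv.Perm S} {u : VG} {w : Option VH}
    (hu : ¬∃ i, (f i).1 = some u) : (some u, w) ∈ SWAP π f σ ↔ (some u, w) ∈ π := by
  push Not at hu
  simp only [SWAP, Finset.mem_union, Finset.mem_sdiff, Finset.mem_image, Finset.mem_filter,
    Finset.mem_univ, true_and, Prod.mk.injEq]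
  refine ⟨?_, fun h => Or.inl ⟨h, ?_⟩⟩
  · rintro (h | ⟨i, -, hi, -⟩)
    · exact h.1
    · exact absurd hi (hu _)
  · rintro ⟨i, hi⟩
    exact hu i (by rw [hi])

theorem mem_SWAP_of_snd_notMem {π : Finset (Option VG × Option VH)}
    {f : S → Option VG × Option VH} {σ : Equiv.Perm S} {w : Option VG} {v : VH}
    (hv : ¬∃ i, (f i).2 = some v) : (w, some v) ∈ SWAP π f σ ↔ (w, some v) ∈ π := by
  push Not at hv
  simp only [SWAP, Finset.mem_union, Finset.mem_sdiff, Finset.mem_image, Finset.mem_filter,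
    Finset.mem_univ, true_and, Prod.mk.injEq]
  refine ⟨?_, fun h => Or.inl ⟨h, ?_⟩⟩
  · rintro (h | ⟨i, -, -, hi⟩)
    · exact h.1
    · exact absurd hi (hv _)
  · rintro ⟨i, hi⟩
    exact hv i (by rw [hi])

end

section

variable {VG VH : Type*} {G : SimpleGraph VG} {H : SimpleGraph VH}
  {π π' : Finset (Option VG × Option VH)}

theorem edgeSub_congr_left {e : Sym2 VG} {fe : Sym2 VH}
    (h : ∀ u ∈ e, ∀ w, (some u, w) ∈ π' ↔ (some u, w) ∈ π) :
    EdgeSub G H π' e fe ↔ EdgeSub G H π e fe := by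
  unfold EdgeSub
  refine and_congr_right fun _ => exists_congr fun u => exists_congr fun u' =>
    exists_congr fun v => exists_congr fun v' => and_congr_right fun he => ?_
  rw [h u (by simp [he]), h u' (by simp [he])]

theorem edgeSub_congr_right {e : Sym2 VG} {fe : Sym2 VH}
    (h : ∀ v ∈ fe, ∀ w, (w, some v) ∈ π' ↔ (w, some v) ∈ π) :
    EdgeSub G H π' e fe ↔ EdgeSub G H π e fe := by
  unfold EdgeSub
  refine and_congr_right fun _ => exists_congr fun u => exists_congr fun u' =>
    exists_congr fun v => exists_congr fun v' => and_congr_right fun _ =>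
    and_congr_right fun hf => ?_
  rw [h v (by simp [hf]), h v' (by simp [hf])]

variable [Fintype VG] [Fintype VH]

theorem sum_nodeCost_eq (cVs : VG → VH → ℝ) (cVd : VG → ℝ) (cVi : VH → ℝ)
    (π : Finset (Option VG × Option VH)) :
    (∑ p ∈ π, match p with
      | (some u, some v) => cVs u v
      | (some u, none) => cVd u
      | (none, some v) => cVi v
      | (none, none) => 0) =
    (∑ u : VG, ∑ v : VH, if (some u, some v) ∈ π then cVs u v else 0)
      + (∑ u : VG, if (some u, (none : Option VH)) ∈ π then cVd u else 0)
      + (∑ v : VH, if ((none : Option VG), some v) ∈ π then cVi v else 0) := by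
  rw [← Finset.filter_univ_mem π, Finset.sum_filter, Fintype.sum_prod_type]
  simp only [Fintype.sum_option, Finset.filter_univ_mem, Finset.sum_add_distrib, ite_self]
  ring

/-- If two sets of assignments agree outside `W` and `X`, their edit costs differ exactly by
their local costs on `W` and `X`. -/
theorem editCost_sub_editCost_eq_localCost_sub_localCost
    (cVs : VG → VH → ℝ) (cVd : VG → ℝ) (cVi : VH → ℝ)
    (cEs : Sym2 VG → Sym2 VH → ℝ) (cEd : Sym2 VG → ℝ) (cEi : Sym2 VH → ℝ)
    {W : Finset VG} {X : Finset VH}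
    (hW : ∀ u ∉ W, ∀ w, (some u, w) ∈ π' ↔ (some u, w) ∈ π)
    (hX : ∀ v ∉ X, ∀ w, (w, some v) ∈ π' ↔ (w, some v) ∈ π) :
    editCost G H cVs cVd cVi cEs cEd cEi π' - editCost G H cVs cVd cVi cEs cEd cEi π
      = localCost G H cVs cVd cVi cEs cEd cEi W X π'
        - localCost G H cVs cVd cVi cEs cEd cEi W X π := by
  have hG : ∀ e ∈ G.edgeFinset, e ∉ G.edgeFinset.filter (fun e => ∃ u ∈ W, u ∈ e) →
      ∀ fe, EdgeSub G H π' e fe ↔ EdgeSub G H π e fe := fun e he heW fe =>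
    edgeSub_congr_left fun u hu =>
      hW u fun huW => heW (Finset.mem_filter.2 ⟨he, u, huW, hu⟩)
  have hH : ∀ fe ∈ H.edgeFinset, fe ∉ H.edgeFinset.filter (fun fe => ∃ v ∈ X, v ∈ fe) →
      ∀ e, EdgeSub G H π' e fe ↔ EdgeSub G H π e fe := fun fe hf hfX e =>
    edgeSub_congr_right fun v hv =>
      hX v fun hvX => hfX (Finset.mem_filter.2 ⟨hf, v, hvX, hv⟩)
  have node_sub := Finset.sum_sub_sum_eq_of_eqOn_compl (Finset.subset_univ W)
    (g' := fun u => ∑ v : VH, if (some u, some v) ∈ π' then cVs u v else 0)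
    (g := fun u => ∑ v : VH, if (some u, some v) ∈ π then cVs u v else 0)
    fun u _ hu => by simp only [hW u hu]
  have node_del := Finset.sum_sub_sum_eq_of_eqOn_compl (Finset.subset_univ W)
    (g' := fun u => if (some u, (none : Option VH)) ∈ π' then cVd u else 0)
    (g := fun u => if (some u, (none : Option VH)) ∈ π then cVd u else 0)
    fun u _ hu => by simp only [hW u hu]
  have node_ins := Finset.sum_sub_sum_eq_of_eqOn_compl (Finset.subset_univ X)
    (g' := fun v => if ((none : Option VG), some v) ∈ π' then cVi v else 0)
    (g := fun v => if ((none : Option VG), some v) ∈ π then cVi v else 0)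
    fun v _ hv => by simp only [hX v hv]
  have edge_sub := Finset.sum_sub_sum_eq_of_eqOn_compl
    (Finset.filter_subset (fun e => ∃ u ∈ W, u ∈ e) G.edgeFinset)
    (g' := fun e => ∑ fe ∈ H.edgeFinset, if EdgeSub G H π' e fe then cEs e fe else 0)
    (g := fun e => ∑ fe ∈ H.edgeFinset, if EdgeSub G H π e fe then cEs e fe else 0)
    fun e he heW => by simp only [hG e he heW]
  have edge_del := Finset.sum_sub_sum_eq_of_eqOn_compl
    (Finset.filter_subset (fun e => ∃ u ∈ W, u ∈ e) G.edgeFinset)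
    (g' := fun e => if ∃ fe : Sym2 VH, EdgeSub G H π' e fe then 0 else cEd e)
    (g := fun e => if ∃ fe : Sym2 VH, EdgeSub G H π e fe then 0 else cEd e)
    fun e he heW => by simp only [hG e he heW]
  have edge_ins := Finset.sum_sub_sum_eq_of_eqOn_compl
    (Finset.filter_subset (fun fe => ∃ v ∈ X, v ∈ fe) H.edgeFinset)
    (g' := fun fe => if ∃ e : Sym2 VG, EdgeSub G H π' e fe then 0 else cEi fe)
    (g := fun fe => if ∃ e : Sym2 VG, EdgeSub G H π e fe then 0 else cEi fe)
    fun fe hf hfX => by simp only [hH fe hf hfX]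
  unfold editCost localCost
  rw [sum_nodeCost_eq, sum_nodeCost_eq]
  linarith

end

/-- Let `π` be a node map, `(f, σ)` a swap of `π` of size `K`, and
`π' := SWAP π f σ` (again a node map). With `V_C^G` and `V_C^H` the sets of nodes of
`G` resp. `H` occurring in a forward assignment of the swap, the difference
`c(P_π') − c(P_π)` equals `Δ`: the local edit cost of `π'` on `V_C^G`, `V_C^H` and
the edges incident with them, minus the corresponding local edit cost of `π`. -/
theorem swap_cost_eq_local_difference {VG VH S : Type*} [Fintype VG] [Fintype VH]
    [Fintype S] (K : ℕ)
    (G : SimpleGraph VG) (H : SimpleGraph VH)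
    (cVs : VG → VH → ℝ) (cVd : VG → ℝ) (cVi : VH → ℝ)
    (cEs : Sym2 VG → Sym2 VH → ℝ) (cEd : Sym2 VG → ℝ) (cEi : Sym2 VH → ℝ)
    (π : Finset (Option VG × Option VH)) (hπ : IsNodeMap π)
    (f : S → Option VG × Option VH) (σ : Equiv.Perm S)
    (hswap : IsSwap π f σ K) :
    editCost G H cVs cVd cVi cEs cEd cEi (SWAP π f σ)
      - editCost G H cVs cVd cVi cEs cEd cEi π
    = localCost G H cVs cVd cVi cEs cEd cEi
        (Finset.univ.filter fun u : VG => ∃ i : S, (f i).1 = some u)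
        (Finset.univ.filter fun v : VH => ∃ i : S, (f i).2 = some v)
        (SWAP π f σ)
      - localCost G H cVs cVd cVi cEs cEd cEi
          (Finset.univ.filter fun u : VG => ∃ i : S, (f i).1 = some u)
          (Finset.univ.filter fun v : VH => ∃ i : S, (f i).2 = some v)
          π := by
  refine editCost_sub_editCost_eq_localCost_sub_localCost cVs cVd cVi cEs cEd cEi
    (fun u hu w => mem_SWAP_of_fst_notMem ?_) (fun v hv w => mem_SWAP_of_snd_notMem ?_)
  · simpa using hu
  · simpa using hv
end

section
/- Let S be a finite type, let a : S → Option α and b : S → Option β be functions, and let σ be a permutation of S. If there is no i : S with a i = none and b i = none, then |{i : S | (a (σ i)).isSome ∧ (b i).isSome}| ≥ |{i : S | (a i).isSome ∧ (b i).isSome}|. -/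
/-- For a finite type `S`, functions `a : S → Option α`,
`b : S → Option β`, and a permutation `σ` of `S`: if no index `i` has both `a i` and
`b i` dummy (`none`), then the number of indices where both `a (σ i)` and `b i` are
non-dummy is at least the number of indices where both `a i` and `b i` are non-dummy. -/
theorem swap_substitution_count_ge {S α β : Type*} [Fintype S] [DecidableEq S]
    [DecidableEq α] [DecidableEq β]
    (a : S → Option α) (b : S → Option β) (σ : Equiv.Perm S)
    (h : ¬ ∃ i : S, a i = none ∧ b i = none) :
    (Finset.univ.filter fun i : S => (a i).isSome ∧ (b i).isSome).card
      ≤ (Finset.univ.filter fun i : S => (a (σ i)).isSome ∧ (b i).isSome).card := by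
  have card_eq : (Finset.univ.filter fun i : S => ((a (σ i)).isSome : Prop)).card
      = (Finset.univ.filter fun i : S => ((a i).isSome : Prop)).card :=
    Finset.card_equiv σ (by simp)
  have union_eq : (Finset.univ.filter fun i : S => ((a i).isSome : Prop))
      ∪ (Finset.univ.filter fun i : S => ((b i).isSome : Prop)) = Finset.univ := by
    ext i
    have hi : ¬ (a i = none ∧ b i = none) := fun hi => h ⟨i, hi⟩
    cases ha : a i <;> cases hb : b i <;> simp_all
  have card_inter := Finset.card_union_add_card_inter
    (Finset.univ.filter fun i : S => ((a i).isSome : Prop))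
    (Finset.univ.filter fun i : S => ((b i).isSome : Prop))
  have card_inter_perm := Finset.card_union_add_card_inter
    (Finset.univ.filter fun i : S => ((a (σ i)).isSome : Prop))
    (Finset.univ.filter fun i : S => ((b i).isSome : Prop))
  have card_union_le := Finset.card_le_univ
    ((Finset.univ.filter fun i : S => ((a (σ i)).isSome : Prop))
      ∪ (Finset.univ.filter fun i : S => ((b i).isSome : Prop)))
  rw [union_eq, Finset.card_univ] at card_inter
  rw [Finset.filter_and, Finset.filter_and]
  omega
end
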